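/- Let γ = {τ_k}_{k=1}^∞ be the impulse-time sequence defined by τ_1 = 1 and τ_{k+1} = τ_k + 1/(k+1) for k ≥ 1. Then γ is strictly increasing with lim_{k→∞} τ_k = ∞ (so γ ∈ Γ), but the singleton {γ} is not uniformly incrementally bounded: indeed, lim_{t_0→∞} n^γ_{(t_0,t_0+1]} = ∞, so there exists no continuous nondecreasing function φ : [0,∞) → [0,∞) with n^γ_{(t_0,t]} ≤ φ(t−t_0) for all t > t_0 ≥ 0. -/

import Mathlib

open MeasureTheory Filter Set
open scoped Classical

noncomputable section

/-- State/input spaces: `ℝ^k` with the Euclidean norm. -/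
abbrev Stt (k : ℕ) : Type := EuclideanSpace ℝ (Fin k)

/-- An impulse-time sequence, identified with its (locally finite) set of impulse
times, a subset of `(0,∞)` with finitely many points below any bound. -/
def IsImpulseSeq (γ : Set ℝ) : Prop :=
  γ ⊆ Set.Ioi (0 : ℝ) ∧ ∀ T : ℝ, (γ ∩ Set.Iic T).Finite

/-- `n^γ_{(s,t]}`: the number of impulse times in the interval `(s,t]`. -/
def nJumps (γ : Set ℝ) (s t : ℝ) : ℕ := (γ ∩ Set.Ioc s t).ncard

/-- Uniform incremental boundedness of a set of impulse-time sequences. -/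
def UIB (S : Set (Set ℝ)) : Prop :=
  ∃ φ : ℝ → ℝ, ContinuousOn φ (Set.Ici 0) ∧ MonotoneOn φ (Set.Ici 0) ∧
    (∀ s : ℝ, 0 ≤ s → 0 ≤ φ s) ∧
    ∀ γ ∈ S, ∀ t0 t : ℝ, 0 ≤ t0 → t0 < t → (nJumps γ t0 t : ℝ) ≤ φ (t - t0)

/-- Class `K∞` functions `[0,∞) → [0,∞)`. -/
def ClassKInf (α : ℝ → ℝ) : Prop :=
  ContinuousOn α (Set.Ici 0) ∧ StrictMonoOn α (Set.Ici 0) ∧ α 0 = 0 ∧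
    ∀ M : ℝ, ∃ r : ℝ, 0 ≤ r ∧ M ≤ α r

/-- Class `KL` functions. -/
def ClassKL (β : ℝ → ℝ → ℝ) : Prop :=
  (∀ t : ℝ, 0 ≤ t → ClassKInf fun r => β r t) ∧
  ∀ r : ℝ, 0 ≤ r → AntitoneOn (fun t => β r t) (Set.Ici 0) ∧
    Filter.Tendsto (fun t => β r t) Filter.atTop (nhds 0)

/-- Positive definite functions `[0,∞) → [0,∞)`. -/
def PosDef (ρ : ℝ → ℝ) : Prop :=
  ContinuousOn ρ (Set.Ici 0) ∧ ρ 0 = 0 ∧ ∀ r : ℝ, 0 < r → 0 < ρ r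

/-- Locally integrable (on compacts) function `[0,∞) → ℝ` (extended to `ℝ`). -/
def LocIntegrable (p : ℝ → ℝ) : Prop :=
  ∀ a b : ℝ, MeasureTheory.IntegrableOn p (Set.Icc a b)

/-- Inputs: measurable, locally essentially bounded functions. -/
def IsInput {m : ℕ} (u : ℝ → Stt m) : Prop :=
  Measurable u ∧ ∀ T : ℝ, ∃ C : ℝ, ∀ᵐ t ∂MeasureTheory.volume, t ∈ Set.Icc 0 T → ‖u t‖ ≤ C

/-- `‖u_I‖_γ`: max of the essential supremum of `‖u‖` over `I` and the supremum of
`‖u‖` over `γ ∩ I`. -/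
def inputNorm {m : ℕ} (γ : Set ℝ) (u : ℝ → Stt m) (I : Set ℝ) : ℝ :=
  max (essSup (fun t => ‖u t‖) (MeasureTheory.volume.restrict I))
      (sSup ((fun t => ‖u t‖) '' (γ ∩ I)))

/-- Solution of the impulsive system `(γ,f,g)` on `[t0,T)` with initial state `x0`
and input `u` (Carathéodory solutions, in integral form, between impulses). -/
structure IsSolution {n m : ℕ} (γ : Set ℝ) (f g : ℝ → Stt n → Stt m → Stt n)
    (t0 : ℝ) (x0 : Stt n) (u : ℝ → Stt m) (T : EReal) (x : ℝ → Stt n) : Prop where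
  lt : (t0 : EReal) < T
  init : x t0 = x0
  flow : ∀ t1 t2 : ℝ, t0 ≤ t1 → t1 ≤ t2 → (t2 : EReal) < T → Set.Ioc t1 t2 ∩ γ = ∅ →
    MeasureTheory.IntegrableOn (fun s => f s (x s) (u s)) (Set.Icc t1 t2) ∧
    x t2 = x t1 + ∫ s in t1..t2, f s (x s) (u s)
  jump : ∀ t ∈ γ, t0 < t → (t : EReal) < T →
    ∃ L : Stt n, Filter.Tendsto x (nhdsWithin t (Set.Iio t)) (nhds L) ∧
      x t = L + g t L (u t)

/-- Maximally defined solution. -/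
def IsMaxSolution {n m : ℕ} (γ : Set ℝ) (f g : ℝ → Stt n → Stt m → Stt n)
    (t0 : ℝ) (x0 : Stt n) (u : ℝ → Stt m) (T : EReal) (x : ℝ → Stt n) : Prop :=
  IsSolution γ f g t0 x0 u T x ∧
    ∀ (T' : EReal) (x' : ℝ → Stt n), IsSolution γ f g t0 x0 u T' x' →
      (∀ t : ℝ, t0 ≤ t → (t : EReal) < T → x' t = x t) → T' ≤ T

/-- Weak `(h⁰,h)`-ISS of a parametrized family of impulsive systems. -/
def WeaklyISS {n m : ℕ} {Λ : Type*} (γ : Λ → Set ℝ)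
    (f g : Λ → ℝ → Stt n → Stt m → Stt n) (h0 h : ℝ → Stt n → ℝ) : Prop :=
  ∃ β : ℝ → ℝ → ℝ, ∃ ρ : ℝ → ℝ, ClassKL β ∧ ClassKInf ρ ∧
    ∀ (l : Λ) (t0 : ℝ) (x0 : Stt n) (u : ℝ → Stt m) (T : EReal) (x : ℝ → Stt n),
      0 ≤ t0 → IsInput u → IsMaxSolution (γ l) (f l) (g l) t0 x0 u T x →
      ∀ t : ℝ, t0 ≤ t → (t : EReal) < T →
        h t (x t) ≤ β (h0 t0 x0) (t - t0) + ρ (inputNorm (γ l) u (Set.Ioc t0 t))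

/-- Strong `(h⁰,h)`-ISS of a parametrized family of impulsive systems. -/
def StronglyISS {n m : ℕ} {Λ : Type*} (γ : Λ → Set ℝ)
    (f g : Λ → ℝ → Stt n → Stt m → Stt n) (h0 h : ℝ → Stt n → ℝ) : Prop :=
  ∃ β : ℝ → ℝ → ℝ, ∃ ρ : ℝ → ℝ, ClassKL β ∧ ClassKInf ρ ∧
    ∀ (l : Λ) (t0 : ℝ) (x0 : Stt n) (u : ℝ → Stt m) (T : EReal) (x : ℝ → Stt n),
      0 ≤ t0 → IsInput u → IsMaxSolution (γ l) (f l) (g l) t0 x0 u T x →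
      ∀ t : ℝ, t0 ≤ t → (t : EReal) < T →
        h t (x t) ≤ β (h0 t0 x0) (t - t0 + (nJumps (γ l) t0 t : ℝ)) +
          ρ (inputNorm (γ l) u (Set.Ioc t0 t))

/-- Locally Lipschitz on a set. -/
def LocLipschitzOn {α β : Type*} [PseudoEMetricSpace α] [PseudoEMetricSpace β]
    (s : Set α) (f : α → β) : Prop :=
  ∀ x ∈ s, ∃ K : NNReal, ∃ t ∈ nhdsWithin x s, LipschitzOnWith K f t

/-- `V ∈ V(γ)` with `Vm` its left-limit function at impulse times: `V` is locally
Lipschitz on each inter-impulse strip and has the joint left limit `Vm τ ξ`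
at each `τ ∈ γ`. -/
def InClassV {n : ℕ} (γ : Set ℝ) (V Vm : ℝ → Stt n → ℝ) : Prop :=
  (∀ a b : ℝ, 0 ≤ a → Set.Ioo a b ∩ γ = ∅ →
    LocLipschitzOn (Set.Ico a b ×ˢ (Set.univ : Set (Stt n)))
      (fun q : ℝ × Stt n => V q.1 q.2)) ∧
  ∀ τ ∈ γ, ∀ ξ : Stt n,
    Filter.Tendsto (fun q : ℝ × Stt n => V q.1 q.2)
      (nhdsWithin (τ, ξ) (Set.Iio τ ×ˢ (Set.univ : Set (Stt n)))) (nhds (Vm τ ξ))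

/-- Upper-right Dini derivative of `V` along the flow map `f`. -/
def DiniAlong {n m : ℕ} (f : ℝ → Stt n → Stt m → Stt n) (V : ℝ → Stt n → ℝ)
    (t : ℝ) (ξ : Stt n) (μ : Stt m) : ℝ :=
  Filter.limsup (fun d : ℝ => (V (t + d) (ξ + d • f t ξ μ) - V t ξ) / d)
    (nhdsWithin 0 (Set.Ioi 0))

/-- Carathéodory function `[0,∞) × [0,∞) → ℝ`. -/
def Caratheodory2 (φ : ℝ → ℝ → ℝ) : Prop :=
  (∀ r : ℝ, Measurable fun t => φ t r) ∧
  (∀ t : ℝ, ContinuousOn (φ t) (Set.Ici 0)) ∧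
  ∀ a b c : ℝ, ∃ mK : ℝ → ℝ, MeasureTheory.IntegrableOn mK (Set.Icc a b) ∧
    ∀ t ∈ Set.Icc a b, ∀ r ∈ Set.Icc (0 : ℝ) c, |φ t r| ≤ mK t

/-- Assumption 1 of the paper, with all the data explicit. -/
def Assumption1 {n m : ℕ} {Λ : Type*} (γ : Λ → Set ℝ)
    (f g : Λ → ℝ → Stt n → Stt m → Stt n) (h0 h : ℝ → Stt n → ℝ)
    (V Vm : Λ → ℝ → Stt n → ℝ) (φ1 φ2 χ π : ℝ → ℝ)
    (vφ al : Λ → ℝ → ℝ → ℝ) : Prop :=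
  ClassKInf φ1 ∧ ClassKInf φ2 ∧ ClassKInf χ ∧ ClassKInf π ∧
  (∀ l : Λ, InClassV (γ l) (V l) (Vm l)) ∧
  (∀ l : Λ, Caratheodory2 (vφ l)) ∧
  (∀ (l : Λ) (t r : ℝ), 0 ≤ t → 0 ≤ r → 0 ≤ al l t r) ∧
  (∀ (l : Λ) (t : ℝ) (ξ : Stt n), 0 ≤ t →
    φ1 (h t ξ) ≤ V l t ξ ∧ V l t ξ ≤ φ2 (h0 t ξ)) ∧
  (∀ (l : Λ) (t : ℝ) (ξ : Stt n) (μ : Stt m), 0 ≤ t → t ∉ γ l → χ ‖μ‖ ≤ V l t ξ →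
    DiniAlong (f l) (V l) t ξ μ ≤ - vφ l t (V l t ξ)) ∧
  (∀ (l : Λ) (t : ℝ) (ξ : Stt n) (μ : Stt m), t ∈ γ l → χ ‖μ‖ ≤ Vm l t ξ →
    V l t (ξ + g l t ξ μ) ≤ al l t (Vm l t ξ)) ∧
  (∀ (l : Λ) (t : ℝ) (ξ : Stt n) (μ : Stt m), t ∈ γ l → Vm l t ξ ≤ χ ‖μ‖ →
    V l t (ξ + g l t ξ μ) ≤ π ‖μ‖)

/-- Solution of the scalar comparison differential/difference inclusion. -/
structure IsCompSol (γ : Set ℝ) (vφ al : ℝ → ℝ → ℝ) (t0 z0 : ℝ) (T : EReal)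
    (z : ℝ → ℝ) : Prop where
  lt : (t0 : EReal) < T
  init : z t0 = z0
  nonneg : ∀ t : ℝ, t0 ≤ t → (t : EReal) < T → 0 ≤ z t
  flow : ∀ t1 t2 : ℝ, t0 ≤ t1 → t1 ≤ t2 → (t2 : EReal) < T → Set.Ioc t1 t2 ∩ γ = ∅ →
    ∃ d : ℝ → ℝ, MeasureTheory.IntegrableOn d (Set.Icc t1 t2) ∧
      (∀ᵐ s ∂MeasureTheory.volume, s ∈ Set.Icc t1 t2 → d s ≤ - vφ s (z s)) ∧
      ∀ t ∈ Set.Icc t1 t2, z t = z t1 + ∫ s in t1..t, d s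
  jump : ∀ t ∈ γ, t0 < t → (t : EReal) < T →
    ∃ L : ℝ, Filter.Tendsto z (nhdsWithin t (Set.Iio t)) (nhds L) ∧ z t ≤ al t L

/-- The family of comparison systems is weakly GUAS. -/
def CompWeakGUAS {Λ : Type*} (γ : Λ → Set ℝ) (vφ al : Λ → ℝ → ℝ → ℝ) : Prop :=
  ∃ β : ℝ → ℝ → ℝ, ClassKL β ∧
    ∀ (l : Λ) (t0 z0 : ℝ) (T : EReal) (z : ℝ → ℝ), 0 ≤ t0 → 0 ≤ z0 →
      IsCompSol (γ l) (vφ l) (al l) t0 z0 T z →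
      ∀ t : ℝ, t0 ≤ t → (t : EReal) < T → z t ≤ β z0 (t - t0)

/-- The family of comparison systems is strongly GUAS. -/
def CompStrongGUAS {Λ : Type*} (γ : Λ → Set ℝ) (vφ al : Λ → ℝ → ℝ → ℝ) : Prop :=
  ∃ β : ℝ → ℝ → ℝ, ClassKL β ∧
    ∀ (l : Λ) (t0 z0 : ℝ) (T : EReal) (z : ℝ → ℝ), 0 ≤ t0 → 0 ≤ z0 →
      IsCompSol (γ l) (vφ l) (al l) t0 z0 T z →
      ∀ t : ℝ, t0 ≤ t → (t : EReal) < T → z t ≤ β z0 (t - t0 + (nJumps (γ l) t0 t : ℝ))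

/-- Nonnegative Carathéodory solution of the scalar ODE `ẇ = rhs(t,w)` on `[t0,T)`. -/
structure IsODESol (rhs : ℝ → ℝ → ℝ) (t0 : ℝ) (T : EReal) (w : ℝ → ℝ) : Prop where
  lt : (t0 : EReal) < T
  nonneg : ∀ t : ℝ, t0 ≤ t → (t : EReal) < T → 0 ≤ w t
  flow : ∀ t1 t2 : ℝ, t0 ≤ t1 → t1 ≤ t2 → (t2 : EReal) < T →
    IntervalIntegrable (fun s => rhs s (w s)) MeasureTheory.volume t1 t2 ∧
    w t2 = w t1 + ∫ s in t1..t2, rhs s (w s)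

/-- Maximally defined forward-in-time solution of `ẇ = rhs(t,w)`. -/
def IsMaxODESol (rhs : ℝ → ℝ → ℝ) (t0 : ℝ) (T : EReal) (w : ℝ → ℝ) : Prop :=
  IsODESol rhs t0 T w ∧
    ∀ (T' : EReal) (w' : ℝ → ℝ), IsODESol rhs t0 T' w' →
      (∀ t : ℝ, t0 ≤ t → (t : EReal) < T → w' t = w t) → T' ≤ T

/-- GUAS of the family of scalar ODEs `ẇ = −φ_λ(t,w)`. -/
def ODEFamilyGUAS {Λ : Type*} (vφ : Λ → ℝ → ℝ → ℝ) : Prop :=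
  ∃ β : ℝ → ℝ → ℝ, ClassKL β ∧
    ∀ (l : Λ) (t0 : ℝ) (T : EReal) (w : ℝ → ℝ), 0 ≤ t0 →
      IsMaxODESol (fun s r => -(vφ l s r)) t0 T w →
      T = (⊤ : EReal) ∧ ∀ t : ℝ, t0 ≤ t → w t ≤ β (w t0) (t - t0)

/-- Solution (on all of `[0,∞)`) of the scalar linear ODE `ẇ = −p(t)·w`. -/
def IsLinSol (p : ℝ → ℝ) (w : ℝ → ℝ) : Prop :=
  ∀ t1 t2 : ℝ, 0 ≤ t1 → t1 ≤ t2 →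
    IntervalIntegrable (fun s => p s * w s) MeasureTheory.volume t1 t2 ∧
    w t2 = w t1 + ∫ s in t1..t2, -(p s * w s)

/-- An impulsive and switching sequence, described through its impulse-time set,
its two switching signals (constant between impulses), and the left limit of the
first switching signal at impulse times. -/
structure SwSignal (Ic Id : Type*) where
  γ : Set ℝ
  σ1 : ℝ → Ic
  σ1m : ℝ → Ic
  σ2 : ℝ → Id
  impulse : IsImpulseSeq γ
  const1 : ∀ a b : ℝ, 0 ≤ a → Set.Ioo a b ∩ γ = ∅ → ∀ t ∈ Set.Ico a b, σ1 t = σ1 a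
  const2 : ∀ a b : ℝ, 0 ≤ a → Set.Ioo a b ∩ γ = ∅ → ∀ t ∈ Set.Ico a b, σ2 t = σ2 a
  leftlim : ∀ t ∈ γ, ∀ᶠ s in nhdsWithin t (Set.Iio t), σ1 s = σ1m t

/-- `σ ∈ SW(J)`. -/
def InSW {Ic Id : Type*} (σ : SwSignal Ic Id) (J : Set (Ic × Ic × Id)) : Prop :=
  ∀ t ∈ σ.γ, (σ.σ1m t, σ.σ1 t, σ.σ2 t) ∈ J

/-- Flow map of the switched impulsive system `Σ_σ`. -/
def swF {n m : ℕ} {Ic Id : Type*} (F : Ic → ℝ → Stt n → Stt m → Stt n)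
    (σ : SwSignal Ic Id) : ℝ → Stt n → Stt m → Stt n :=
  fun t ξ μ => F (σ.σ1 t) t ξ μ

/-- Jump map of the switched impulsive system `Σ_σ`. -/
def swG {n m : ℕ} {Ic Id : Type*} (G : Id → ℝ → Stt n → Stt m → Stt n)
    (σ : SwSignal Ic Id) : ℝ → Stt n → Stt m → Stt n :=
  fun t ξ μ => G (σ.σ2 t) t ξ μ

/-- Weak `(h⁰,h)`-ISS of the family `{Σ_σ}_{σ ∈ SW}`. -/
def SwWeaklyISS {n m : ℕ} {Ic Id : Type*} (F : Ic → ℝ → Stt n → Stt m → Stt n)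
    (G : Id → ℝ → Stt n → Stt m → Stt n) (SW : Set (SwSignal Ic Id))
    (h0 h : ℝ → Stt n → ℝ) : Prop :=
  ∃ β : ℝ → ℝ → ℝ, ∃ ρ : ℝ → ℝ, ClassKL β ∧ ClassKInf ρ ∧
    ∀ σ ∈ SW, ∀ (t0 : ℝ) (x0 : Stt n) (u : ℝ → Stt m) (T : EReal) (x : ℝ → Stt n),
      0 ≤ t0 → IsInput u → IsMaxSolution σ.γ (swF F σ) (swG G σ) t0 x0 u T x →
      ∀ t : ℝ, t0 ≤ t → (t : EReal) < T →
        h t (x t) ≤ β (h0 t0 x0) (t - t0) + ρ (inputNorm σ.γ u (Set.Ioc t0 t))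

/-- Strong `(h⁰,h)`-ISS of the family `{Σ_σ}_{σ ∈ SW}`. -/
def SwStronglyISS {n m : ℕ} {Ic Id : Type*} (F : Ic → ℝ → Stt n → Stt m → Stt n)
    (G : Id → ℝ → Stt n → Stt m → Stt n) (SW : Set (SwSignal Ic Id))
    (h0 h : ℝ → Stt n → ℝ) : Prop :=
  ∃ β : ℝ → ℝ → ℝ, ∃ ρ : ℝ → ℝ, ClassKL β ∧ ClassKInf ρ ∧
    ∀ σ ∈ SW, ∀ (t0 : ℝ) (x0 : Stt n) (u : ℝ → Stt m) (T : EReal) (x : ℝ → Stt n),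
      0 ≤ t0 → IsInput u → IsMaxSolution σ.γ (swF F σ) (swG G σ) t0 x0 u T x →
      ∀ t : ℝ, t0 ≤ t → (t : EReal) < T →
        h t (x t) ≤ β (h0 t0 x0) (t - t0 + (nJumps σ.γ t0 t : ℝ)) +
          ρ (inputNorm σ.γ u (Set.Ioc t0 t))

/-- Total activation time in `(t0,t]` of the flow modes in `A`. -/
def actT {Ic Id : Type*} (σ : SwSignal Ic Id) (A : Set Ic) (t0 t : ℝ) : ℝ :=
  (MeasureTheory.volume {r : ℝ | r ∈ Set.Ioc t0 t ∧ σ.σ1 r ∈ A}).toReal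

/-- Number of impulse times in `(t0,t]` whose mode combination lies in `Jp`. -/
def nJumpsIn {Ic Id : Type*} (σ : SwSignal Ic Id) (Jp : Set (Ic × Ic × Id))
    (t0 t : ℝ) : ℕ :=
  (σ.γ ∩ Set.Ioc t0 t ∩ {r : ℝ | (σ.σ1m r, σ.σ1 r, σ.σ2 r) ∈ Jp}).ncard

/-- Assumption 2 of the paper (for switched impulsive systems), data explicit. -/
def Assumption2 {n m : ℕ} {Ic Id : Type*}
    (F : Ic → ℝ → Stt n → Stt m → Stt n) (G : Id → ℝ → Stt n → Stt m → Stt n)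
    (h0 h : ℝ → Stt n → ℝ) (J : Set (Ic × Ic × Id))
    (v : Ic → ℝ → Stt n → ℝ) (φ1 φ2 χ π : ℝ → ℝ)
    (vφ : Ic → ℝ → ℝ → ℝ) (al : Ic × Ic × Id → ℝ → ℝ → ℝ) : Prop :=
  ClassKInf φ1 ∧ ClassKInf φ2 ∧ ClassKInf χ ∧ ClassKInf π ∧
  (∀ i : Ic, LocLipschitzOn ((Set.Ici (0 : ℝ)) ×ˢ (Set.univ : Set (Stt n)))
      (fun q : ℝ × Stt n => v i q.1 q.2)) ∧
  (∀ i : Ic, Caratheodory2 (vφ i)) ∧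
  (∀ e ∈ J, ∀ t r : ℝ, 0 ≤ t → 0 ≤ r → 0 ≤ al e t r) ∧
  (∀ (i : Ic) (t : ℝ) (ξ : Stt n), 0 ≤ t →
    φ1 (h t ξ) ≤ v i t ξ ∧ v i t ξ ≤ φ2 (h0 t ξ)) ∧
  (∀ (i : Ic) (t : ℝ) (ξ : Stt n) (μ : Stt m), 0 ≤ t → χ ‖μ‖ ≤ v i t ξ →
    DiniAlong (F i) (v i) t ξ μ ≤ - vφ i t (v i t ξ)) ∧
  (∀ (ι i : Ic) (j : Id), (ι, i, j) ∈ J → ∀ (t : ℝ) (ξ : Stt n) (μ : Stt m),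
    0 ≤ t → χ ‖μ‖ ≤ v ι t ξ → v i t (ξ + G j t ξ μ) ≤ al (ι, i, j) t (v ι t ξ)) ∧
  (∀ (ι i : Ic) (j : Id), (ι, i, j) ∈ J → ∀ (t : ℝ) (ξ : Stt n) (μ : Stt m),
    0 ≤ t → v ι t ξ ≤ χ ‖μ‖ → v i t (ξ + G j t ξ μ) ≤ π ‖μ‖)

theorem exists_forall_mem_Ioc_of_increment_le {τ : ℕ → ℝ}
    (hτ : Tendsto τ atTop atTop)
    (hinc : ∀ k : ℕ, 1 ≤ k → τ (k + 1) ≤ τ k + 1 / ((k : ℝ) + 1))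
    (hmono : ∀ j k : ℕ, 1 ≤ j → j ≤ k → τ j ≤ τ k)
    {N : ℕ} (hN : 1 ≤ N) {t : ℝ} (ht : τ N ≤ t) :
    ∃ m : ℕ, N ≤ m ∧ ∀ j : ℕ, 1 ≤ j → j ≤ N → τ (m + j) ∈ Set.Ioc t (t + 1) := by
  have hex : ∃ k, 1 ≤ k ∧ t < τ k :=
    ((eventually_ge_atTop 1).and (hτ.eventually_gt_atTop t)).exists
  obtain ⟨hm1, hmt⟩ := Nat.find_spec hex
  have hmin : ∀ k, k < Nat.find hex → 1 ≤ k → τ k ≤ t := fun k hk h1 =>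
    not_lt.1 fun h => Nat.find_min hex hk ⟨h1, h⟩
  generalize Nat.find hex = p at hm1 hmt hmin
  have hNp : N < p := by
    by_contra! h
    linarith [hmono p N hm1 h]
  obtain ⟨m, rfl⟩ : ∃ m, p = m + 1 := ⟨p - 1, by omega⟩
  refine ⟨m, by omega, fun j hj1 hjN => ⟨hmt.trans_le (hmono _ _ hm1 (by omega)), ?_⟩⟩
  have hm0 : (0 : ℝ) < m := by exact_mod_cast (by omega : 0 < m)
  have hstep : ∀ j : ℕ, τ (m + j) ≤ τ m + (j : ℝ) / m := by
    intro j
    induction j with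
    | zero => simp
    | succ j ih =>
      have h := hinc (m + j) (by omega)
      have hle : 1 / (((m + j : ℕ) : ℝ) + 1) ≤ 1 / (m : ℝ) := by
        apply one_div_le_one_div_of_le hm0
        push_cast
        linarith [(Nat.cast_nonneg j : (0 : ℝ) ≤ j)]
      have hadd : ((j + 1 : ℕ) : ℝ) / m = (j : ℝ) / m + 1 / m := by
        push_cast
        ring
      rw [hadd, ← add_assoc m j 1]
      linarith
  have hdiv : (j : ℝ) / m ≤ 1 := by
    rw [div_le_one hm0]
    exact_mod_cast (by omega : j ≤ m)
  linarith [hstep j, hmin m (by omega) (by omega)]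

theorem not_UIB_singleton_of_tendsto_nJumps {γ : Set ℝ}
    (h : Tendsto (fun t : ℝ => nJumps γ t (t + 1)) atTop atTop) : ¬ UIB {γ} := by
  rintro ⟨φ, -, -, -, hφ⟩
  obtain ⟨n, hn⟩ := exists_nat_gt (φ 1)
  obtain ⟨t, ht, hnt⟩ :=
    ((eventually_ge_atTop (0 : ℝ)).and (h.eventually_ge_atTop n)).exists
  have hle := hφ γ rfl t (t + 1) ht (by linarith)
  rw [add_sub_cancel_left] at hle
  have : (n : ℝ) ≤ nJumps γ t (t + 1) := by exact_mod_cast hnt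
  linarith

/-- Example 1: the impulse-time sequence `τ_1 = 1`, `τ_{k+1} = τ_k + 1/(k+1)` is
a genuine impulse-time sequence whose singleton family is not UIB. -/
theorem stmt19 (τ : ℕ → ℝ) (hτ1 : τ 1 = 1)
    (hτr : ∀ k : ℕ, 1 ≤ k → τ (k + 1) = τ k + 1 / ((k : ℝ) + 1))
    (γ : Set ℝ) (hγdef : γ = {x : ℝ | ∃ k : ℕ, 1 ≤ k ∧ τ k = x}) :
    (∀ j k : ℕ, 1 ≤ j → j < k → τ j < τ k) ∧
    Filter.Tendsto τ Filter.atTop Filter.atTop ∧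
    IsImpulseSeq γ ∧
    Filter.Tendsto (fun t0 : ℝ => nJumps γ t0 (t0 + 1)) Filter.atTop Filter.atTop ∧
    ¬ UIB {γ} := by
  have hlt : ∀ j k : ℕ, 1 ≤ j → j < k → τ j < τ k := by
    intro j k hj hjk
    induction k, hjk using Nat.le_induction with
    | base =>
      rw [hτr j hj]
      exact lt_add_of_pos_right _ (by positivity)
    | succ k hk ih =>
      rw [hτr k (by omega)]
      exact ih.trans (lt_add_of_pos_right _ (by positivity))
  have hle : ∀ j k : ℕ, 1 ≤ j → j ≤ k → τ j ≤ τ k := fun j k hj hjk =>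
    hjk.eq_or_lt.elim (fun h => h ▸ le_rfl) fun h => (hlt j k hj h).le
  have hsum : ∀ k : ℕ, 1 ≤ k → τ k = ∑ i ∈ Finset.range k, 1 / ((i : ℝ) + 1) := by
    intro k hk
    induction k, hk using Nat.le_induction with
    | base => simp [hτ1]
    | succ k hk ih => rw [hτr k hk, ih, Finset.sum_range_succ]
  have htend : Tendsto τ atTop atTop :=
    Real.tendsto_sum_range_one_div_nat_succ_atTop.congr'
      ((eventually_ge_atTop 1).mono fun k hk => (hsum k hk).symm)
  have hfin : ∀ T : ℝ, (γ ∩ Set.Iic T).Finite := by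
    intro T
    obtain ⟨N, hN⟩ := eventually_atTop.1 (htend.eventually_gt_atTop T)
    refine ((Set.finite_Iio N).image τ).subset ?_
    rintro x ⟨hx, hxT⟩
    rw [hγdef] at hx
    obtain ⟨k, -, rfl⟩ := hx
    exact ⟨k, lt_of_not_ge fun h => (hN k h).not_ge hxT, rfl⟩
  have hjumps : Tendsto (fun t0 : ℝ => nJumps γ t0 (t0 + 1)) atTop atTop := by
    refine tendsto_atTop.2 fun n => ?_
    filter_upwards [eventually_ge_atTop (τ (n + 1))] with t ht
    obtain ⟨m, -, hm⟩ := exists_forall_mem_Ioc_of_increment_le htend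
      (fun k hk => (hτr k hk).le) hle (Nat.succ_pos n) ht
    have hinj : Set.InjOn (fun j => τ (m + j)) (Finset.Icc 1 (n + 1) : Finset ℕ) := by
      intro i hi j hj hij
      simp only [Finset.coe_Icc, Set.mem_Icc] at hi hj
      rcases lt_trichotomy i j with h | h | h
      · exact absurd hij (hlt (m + i) (m + j) (by omega) (by omega)).ne
      · exact h
      · exact absurd hij (hlt (m + j) (m + i) (by omega) (by omega)).ne'
    have hsub : (fun j => τ (m + j)) '' (Finset.Icc 1 (n + 1) : Finset ℕ) ⊆
        γ ∩ Set.Ioc t (t + 1) := by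
      rintro _ ⟨j, hj, rfl⟩
      simp only [Finset.coe_Icc, Set.mem_Icc] at hj
      exact ⟨hγdef ▸ ⟨m + j, by omega, rfl⟩, hm j hj.1 hj.2⟩
    have hcard := Set.ncard_le_ncard hsub
      ((hfin (t + 1)).subset (Set.inter_subset_inter_right _ fun _ hx => hx.2))
    rw [hinj.ncard_image, Set.ncard_coe_finset, Nat.card_Icc] at hcard
    exact (by omega : n ≤ n + 1 + 1 - 1).trans hcard
  refine ⟨hlt, htend, ⟨?_, hfin⟩, hjumps, not_UIB_singleton_of_tendsto_nJumps hjumps⟩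
  rw [hγdef]
  rintro _ ⟨k, hk, rfl⟩
  exact zero_lt_one.trans_le (hτ1 ▸ hle 1 k le_rfl hk)

end
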